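/- Let M (buses), L (lines), K, and W (FTR contracts) be finite index sets. Let Γ : L × M → ℝ, d : M → ℝ (loads), g : M → ℝ (bus generation), Pinj(m) = g(m) − d(m) with Σ_{m} Pinj(m) = 0, F : L → ℝ, λ ∈ ℝ, nonnegative multipliers η̄, η_ : L → ℝ and, for each k ∈ K, λᵏ ∈ ℝ and nonnegative η̄ᵏ, η_ᵏ : L → ℝ, uncertainty vectors ε̂ᵏ : M → ℝ, and re-dispatch ΔGᵏ : M → ℝ with Σ_{m} ΔGᵏ(m) = Σ_{m} ε̂ᵏ(m). Define f(l) = Σ_{m} Γ(l,m)·Pinj(m), Δf_pos(l) = F(l) − f(l), Δf_neg(l) = F(l) + f(l), ΔPinjᵏ(m) = ΔGᵏ(m) − ε̂ᵏ(m), the LMPs πe(m) = λ − Σ_{l} Γ(l,m)·(η̄(l) − η_(l)) − Σ_{l} Σ_{k} Γ(l,m)·(η̄ᵏ(l) − η_ᵏ(l)), and the UMPs πᵏ(m) = λᵏ − Σ_{l} Γ(l,m)·(η̄ᵏ(l) − η_ᵏ(l)). Assume: (i) η̄(l)·Δf_pos(l) = 0 and η_(l)·Δf_neg(l) = 0 for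 every l; (ii) for every k and l, η̄ᵏ(l)·(F(l) − Σ_{m} Γ(l,m)·(Pinj(m) + ΔPinjᵏ(m))) = 0 and η_ᵏ(l)·(F(l) + Σ_{m} Γ(l,m)·(Pinj(m) + ΔPinjᵏ(m))) = 0; (iii) σ, τ : W → M and FTR : W → ℝ satisfy |Σ_{w} (Γ(l,σ(w)) − Γ(l,τ(w)))·FTR(w)| ≤ F(l) for every l. Then Σ_{m} πe(m)·d(m) + Σ_{k} Σ_{m} πᵏ(m)·ε̂ᵏ(m) ≥ Σ_{m} πe(m)·g(m) + Σ_{k} Σ_{m} πᵏ(m)·ΔGᵏ(m) + Σ_{w} (πe(σ(w)) − πe(τ(w)))·FTR(w). -/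

import Mathlib

/-- Value of injections `x` at prices made of a uniform part `a` and a congestion part. -/
theorem sum_price_mul {M L : Type*} [Fintype M] [Fintype L]
    (Γ : L → M → ℝ) (a : ℝ) (c : L → ℝ) (x : M → ℝ) :
    ∑ m, (a - ∑ l, Γ l m * c l) * x m = a * ∑ m, x m - ∑ l, c l * ∑ m, Γ l m * x m := by
  simp only [sub_mul, Finset.sum_sub_distrib, Finset.mul_sum, Finset.sum_mul]
  rw [Finset.sum_comm (γ := L)]
  congr 1
  exact Finset.sum_congr rfl fun l _ => Finset.sum_congr rfl fun m _ => by ring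

/-- Complementary slackness for a two-sided flow limit `F` makes the congestion rent of the
flow `y` at least the value of any other flow `s` within the limit. -/
theorem congestion_rent_nonneg {p q F y s : ℝ} (hp : 0 ≤ p) (hq : 0 ≤ q)
    (hpy : p * (F - y) = 0) (hqy : q * (F + y) = 0) (hs : |s| ≤ F) :
    0 ≤ (p - q) * (y + s) := by
  obtain ⟨h₁, h₂⟩ := abs_le.mp hs
  have h₃ : 0 ≤ p * (F + s) := mul_nonneg hp (by linarith)
  have h₄ : 0 ≤ q * (F - s) := mul_nonneg hq (by linarith)
  linarith


open Finset in
/-- Revenue adequacy (Theorem 2): payments from loads and uncertainty sources cover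
the credits to energy producers, generation reserves, and FTR holders. -/
theorem revenue_adequacy
    {M L K W : Type*} [Fintype M] [Fintype L] [Fintype K] [Fintype W]
    (Γ : L → M → ℝ) (d g : M → ℝ)
    (Pinj : M → ℝ) (hPinj : ∀ m, Pinj m = g m - d m)
    (hbal : ∑ m, Pinj m = 0)
    (F : L → ℝ) (lam : ℝ)
    (η' η : L → ℝ) (lamk : K → ℝ) (η'k ηk : K → L → ℝ)
    (hη' : ∀ l, 0 ≤ η' l) (hη : ∀ l, 0 ≤ η l)
    (hη'k : ∀ k l, 0 ≤ η'k k l) (hηk : ∀ k l, 0 ≤ ηk k l)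
    (ε ΔG : K → M → ℝ)
    (hbalk : ∀ k, ∑ m, ΔG k m = ∑ m, ε k m)
    (f : L → ℝ) (hf : ∀ l, f l = ∑ m, Γ l m * Pinj m)
    (Δfpos Δfneg : L → ℝ)
    (hpos : ∀ l, Δfpos l = F l - f l) (hneg : ∀ l, Δfneg l = F l + f l)
    (ΔPinj : K → M → ℝ) (hΔPinj : ∀ k m, ΔPinj k m = ΔG k m - ε k m)
    (πe : M → ℝ)
    (hπe : ∀ m, πe m = lam - (∑ l, Γ l m * (η' l - η l))
        - ∑ l, ∑ k, Γ l m * (η'k k l - ηk k l))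
    (πk : K → M → ℝ)
    (hπk : ∀ k m, πk k m = lamk k - ∑ l, Γ l m * (η'k k l - ηk k l))
    (hcs1 : ∀ l, η' l * Δfpos l = 0) (hcs2 : ∀ l, η l * Δfneg l = 0)
    (hcsk1 : ∀ k l, η'k k l * (F l - ∑ m, Γ l m * (Pinj m + ΔPinj k m)) = 0)
    (hcsk2 : ∀ k l, ηk k l * (F l + ∑ m, Γ l m * (Pinj m + ΔPinj k m)) = 0)
    (σ τ : W → M) (FTR : W → ℝ)
    (hSFT : ∀ l, |∑ w, (Γ l (σ w) - Γ l (τ w)) * FTR w| ≤ F l) :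
    (∑ m, πe m * d m) + (∑ k, ∑ m, πk k m * ε k m) ≥
      (∑ m, πe m * g m) + (∑ k, ∑ m, πk k m * ΔG k m)
        + ∑ w, (πe (σ w) - πe (τ w)) * FTR w := by
  set B : K → L → ℝ := fun k l => η'k k l - ηk k l with hB
  set c : L → ℝ := fun l => (η' l - η l) + ∑ k, B k l with hc
  set S : L → ℝ := fun l => ∑ w, (Γ l (σ w) - Γ l (τ w)) * FTR w with hS
  have price : ∀ m, πe m = lam - ∑ l, Γ l m * c l := by
    intro m
    rw [hπe, sub_sub, ← Finset.sum_add_distrib]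
    simp only [hc, hB, mul_add, Finset.mul_sum]
  have energy : ∑ m, πe m * g m - ∑ m, πe m * d m = -∑ l, c l * f l := by
    rw [← Finset.sum_sub_distrib]
    simp only [← mul_sub, ← hPinj, price, sum_price_mul, hbal, hf]
    ring
  have reserve : ∑ k, ∑ m, πk k m * ΔG k m - ∑ k, ∑ m, πk k m * ε k m
      = -∑ l, ∑ k, B k l * ∑ m, Γ l m * ΔPinj k m := by
    have hbalΔ : ∀ k, ∑ m, ΔPinj k m = 0 := fun k => by
      simp only [hΔPinj, Finset.sum_sub_distrib, hbalk, sub_self]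
    rw [← Finset.sum_sub_distrib, Finset.sum_comm (γ := L), ← Finset.sum_neg_distrib]
    refine Finset.sum_congr rfl fun k _ => ?_
    have h := sum_price_mul Γ (lamk k) (B k) (ΔPinj k)
    rw [hbalΔ, mul_zero, zero_sub] at h
    rw [← h, ← Finset.sum_sub_distrib]
    refine Finset.sum_congr rfl fun m _ => ?_
    rw [← hπk, hΔPinj, mul_sub]
  have ftr : ∑ w, (πe (σ w) - πe (τ w)) * FTR w = -∑ l, c l * S l := by
    simp only [hS, Finset.mul_sum]
    rw [Finset.sum_comm, ← Finset.sum_neg_distrib]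
    refine Finset.sum_congr rfl fun w _ => ?_
    rw [price, price, sub_sub_sub_cancel_left, ← Finset.sum_sub_distrib, Finset.sum_mul,
      ← Finset.sum_neg_distrib]
    exact Finset.sum_congr rfl fun l _ => by ring
  have rent : 0 ≤ ∑ l, (c l * f l + (∑ k, B k l * ∑ m, Γ l m * ΔPinj k m) + c l * S l) := by
    refine Finset.sum_nonneg fun l _ => ?_
    have base : 0 ≤ (η' l - η l) * (f l + S l) :=
      congestion_rent_nonneg (hη' l) (hη l) (hpos l ▸ hcs1 l) (hneg l ▸ hcs2 l) (hSFT l)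
    have post : 0 ≤ ∑ k, B k l * ((∑ m, Γ l m * (Pinj m + ΔPinj k m)) + S l) :=
      Finset.sum_nonneg fun k _ =>
        congestion_rent_nonneg (hη'k k l) (hηk k l) (hcsk1 k l) (hcsk2 k l) (hSFT l)
    simp only [mul_add, Finset.sum_add_distrib, ← hf, ← Finset.sum_mul] at base post
    simp only [hc, add_mul]
    linarith
  simp only [Finset.sum_add_distrib] at rent
  linarith
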